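/- Every positive integer n not of the form 4^a(8b+7) for any non-negative integers a, b can be written as n = m1^2 + m2^2 + m3^2 for some non-negative integers m1, m2, m3 with gcd(m1, m2, m3) = 2^l, where l is the non-negative integer satisfying 4^l ∣ n and 4^(l+1) ∤ n. -/

import Mathlib

/-- Every positive definite binary form is equivalent to one with small leading coefficient. -/
theorem binary_reduce (N : ℕ) : ∀ p q r : ℤ, p.toNat ≤ N → 0 < p → 0 < p * r - q ^ 2 →
    ∃ α β γ δ : ℤ, α * δ - β * γ = 1 ∧ 0 < p * α ^ 2 + 2 * q * α * γ + r * γ ^ 2 ∧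
      3 * (p * α ^ 2 + 2 * q * α * γ + r * γ ^ 2) ^ 2 ≤ 4 * (p * r - q ^ 2) := by
  induction N with
  | zero => intro p q r h1 h2; omega
  | succ N ih =>
    intro p q r hN hp hD
    obtain ⟨k, hk1, hk2⟩ : ∃ k : ℤ, -p ≤ 2 * (q + k * p) ∧ 2 * (q + k * p) ≤ p := by
      refine ⟨-((2 * q + p) / (2 * p)), ?_, ?_⟩ <;>
      · have h1 := Int.emod_add_mul_ediv (2 * q + p) (2 * p)
        have h2 := Int.emod_nonneg (2 * q + p) (b := 2 * p) (by omega)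
        have h3 := Int.emod_lt_of_pos (2 * q + p) (b := 2 * p) (by omega)
        nlinarith
    obtain ⟨q', hq'⟩ : ∃ q', q' = q + k * p := ⟨_, rfl⟩
    obtain ⟨r', hr'⟩ : ∃ r', r' = r + 2 * k * q + k ^ 2 * p := ⟨_, rfl⟩
    rw [← hq'] at hk1 hk2
    have hD' : p * r' - q' ^ 2 = p * r - q ^ 2 := by subst hq' hr'; ring
    by_cases h : p ≤ r'
    · refine ⟨1, 0, 0, 1, by norm_num, by nlinarith, ?_⟩
      rw [← hD']
      nlinarith
    · have hr0 : 0 < r' := by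
        by_contra hc
        nlinarith [sq_nonneg q']
      obtain ⟨α, β, γ, δ, h1, h2, h3⟩ := ih r' (-q') p (by omega) hr0 (by nlinarith)
      have e : p * (k * α - γ) ^ 2 + 2 * q * (k * α - γ) * α + r * α ^ 2 =
          r' * α ^ 2 + 2 * (-q') * α * γ + p * γ ^ 2 := by
        subst hq' hr'; ring
      refine ⟨k * α - γ, k * β - δ, α, β, by linear_combination h1, ?_, ?_⟩
      · rw [e]; exact h2
      · rw [e]; linarith

/-- The Gram matrix `[[a,b,c],[b,d,e],[c,e,f]]` is realised by integer vectors. -/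
def IsGram (a b c d e f : ℤ) : Prop :=
  ∃ u₁ u₂ u₃ v₁ v₂ v₃ w₁ w₂ w₃ : ℤ,
    a = u₁ ^ 2 + u₂ ^ 2 + u₃ ^ 2 ∧ b = u₁ * v₁ + u₂ * v₂ + u₃ * v₃ ∧
    c = u₁ * w₁ + u₂ * w₂ + u₃ * w₃ ∧ d = v₁ ^ 2 + v₂ ^ 2 + v₃ ^ 2 ∧
    e = v₁ * w₁ + v₂ * w₂ + v₃ * w₃ ∧ f = w₁ ^ 2 + w₂ ^ 2 + w₃ ^ 2

theorem IsGram.swap {a b c d e f : ℤ} (h : IsGram d b e a c f) : IsGram a b c d e f := by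
  obtain ⟨u₁, u₂, u₃, v₁, v₂, v₃, w₁, w₂, w₃, h1, h2, h3, h4, h5, h6⟩ := h
  exact ⟨v₁, v₂, v₃, u₁, u₂, u₃, w₁, w₂, w₃, by linarith, by linarith, by linarith, by linarith,
    by linarith, by linarith⟩

theorem IsGram.shift {a b c d e f : ℤ} (k l : ℤ)
    (h : IsGram a (b + k * a) (c + l * a) (d + 2 * k * b + k ^ 2 * a)
      (e + k * c + l * b + k * l * a) (f + 2 * l * c + l ^ 2 * a)) : IsGram a b c d e f := by
  obtain ⟨u₁, u₂, u₃, v₁, v₂, v₃, w₁, w₂, w₃, h1, h2, h3, h4, h5, h6⟩ := h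
  refine ⟨u₁, u₂, u₃, v₁ - k * u₁, v₂ - k * u₂, v₃ - k * u₃, w₁ - l * u₁, w₂ - l * u₂,
    w₃ - l * u₃, h1, ?_, ?_, ?_, ?_, ?_⟩
  · linear_combination h2 - k * h1
  · linear_combination h3 - l * h1
  · linear_combination h4 - 2 * k * h2 + k ^ 2 * h1
  · linear_combination h5 - k * h3 - l * h2 + k * l * h1
  · linear_combination h6 - 2 * l * h3 + l ^ 2 * h1

theorem IsGram.sl {a b c d e f : ℤ} (α β γ δ : ℤ) (hdet : α * δ - β * γ = 1)
    (h : IsGram a (α * b + γ * c) (β * b + δ * c) (α ^ 2 * d + 2 * α * γ * e + γ ^ 2 * f)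
      (α * β * d + (α * δ + β * γ) * e + γ * δ * f)
      (β ^ 2 * d + 2 * β * δ * e + δ ^ 2 * f)) : IsGram a b c d e f := by
  obtain ⟨u₁, u₂, u₃, v₁, v₂, v₃, w₁, w₂, w₃, h1, h2, h3, h4, h5, h6⟩ := h
  refine ⟨u₁, u₂, u₃, δ * v₁ - γ * w₁, δ * v₂ - γ * w₂, δ * v₃ - γ * w₃,
    α * w₁ - β * v₁, α * w₂ - β * v₂, α * w₃ - β * v₃, h1, ?_, ?_, ?_, ?_, ?_⟩
  · linear_combination δ * h2 - γ * h3 - b * hdet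
  · linear_combination α * h3 - β * h2 - c * hdet
  · linear_combination δ ^ 2 * h4 - 2 * γ * δ * h5 + γ ^ 2 * h6
      - d * (α * δ - β * γ + 1) * hdet
  · linear_combination -δ * β * h4 + (α * δ + β * γ) * h5 - α * γ * h6
      - e * (α * δ - β * γ + 1) * hdet
  · linear_combination β ^ 2 * h4 - 2 * α * β * h5 + α ^ 2 * h6
      - f * (α * δ - β * γ + 1) * hdet

theorem shift_small (p q : ℤ) (hp : 0 < p) :
    ∃ k : ℤ, -p ≤ 2 * (q + k * p) ∧ 2 * (q + k * p) ≤ p := by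
  refine ⟨-((2 * q + p) / (2 * p)), ?_, ?_⟩ <;>
  · have h1 := Int.emod_add_mul_ediv (2 * q + p) (2 * p)
    have h2 := Int.emod_nonneg (2 * q + p) (b := 2 * p) (by omega)
    have h3 := Int.emod_lt_of_pos (2 * q + p) (b := 2 * p) (by omega)
    nlinarith

/-- Positive definite integral ternary forms of determinant one are sums of three squares. -/
theorem ternary (N : ℕ) : ∀ a b c d e f : ℤ, a.toNat ≤ N → 0 < a → 0 < a * d - b ^ 2 →
    a * d * f + 2 * b * c * e - a * e ^ 2 - d * c ^ 2 - f * b ^ 2 = 1 → IsGram a b c d e f := by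
  induction N with
  | zero => intro a b c d e f h1 h2; omega
  | succ N ih =>
    intro a b c d e f hN ha hm hdet
    have hG : (a * d - b ^ 2) * (a * f - c ^ 2) - (a * e - b * c) ^ 2 = a := by
      linear_combination a * hdet
    obtain ⟨α, β, γ, δ, h1, h2, h3⟩ := binary_reduce _ (a * d - b ^ 2) (a * e - b * c)
      (a * f - c ^ 2) le_rfl hm (by rw [hG]; exact ha)
    rw [hG] at h3
    apply IsGram.sl α β γ δ h1
    obtain ⟨b', hb⟩ : ∃ x, x = α * b + γ * c := ⟨_, rfl⟩
    obtain ⟨c', hc⟩ : ∃ x, x = β * b + δ * c := ⟨_, rfl⟩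
    obtain ⟨d', hd⟩ : ∃ x, x = α ^ 2 * d + 2 * α * γ * e + γ ^ 2 * f := ⟨_, rfl⟩
    obtain ⟨e', he⟩ : ∃ x, x = α * β * d + (α * δ + β * γ) * e + γ * δ * f := ⟨_, rfl⟩
    obtain ⟨f', hf⟩ : ∃ x, x = β ^ 2 * d + 2 * β * δ * e + δ ^ 2 * f := ⟨_, rfl⟩
    rw [← hb, ← hc, ← hd, ← he, ← hf]
    have hg : (a * d - b ^ 2) * α ^ 2 + 2 * (a * e - b * c) * α * γ + (a * f - c ^ 2) * γ ^ 2
        = a * d' - b' ^ 2 := by subst hb hd; ring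
    rw [hg] at h2 h3
    have hdet' : a * d' * f' + 2 * b' * c' * e' - a * e' ^ 2 - d' * c' ^ 2 - f' * b' ^ 2 = 1 := by
      have : a * d' * f' + 2 * b' * c' * e' - a * e' ^ 2 - d' * c' ^ 2 - f' * b' ^ 2 =
        (α * δ - β * γ) ^ 2 *
          (a * d * f + 2 * b * c * e - a * e ^ 2 - d * c ^ 2 - f * b ^ 2) := by
        subst hb hc hd he hf; ring
      rw [this, h1, hdet]; norm_num
    clear hg hb hc hd he hf h1 hG hdet hm
    clear b c d e f α β γ δ
    obtain ⟨k, hk1, hk2⟩ := shift_small a b' ha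
    apply IsGram.shift k 0
    obtain ⟨b, hb⟩ : ∃ x, x = b' + k * a := ⟨_, rfl⟩
    obtain ⟨d, hd⟩ : ∃ x, x = d' + 2 * k * b' + k ^ 2 * a := ⟨_, rfl⟩
    obtain ⟨c, hc⟩ : ∃ x, x = c' + 0 * a := ⟨_, rfl⟩
    obtain ⟨e, he⟩ : ∃ x, x = e' + k * c' + 0 * b' + k * 0 * a := ⟨_, rfl⟩
    obtain ⟨f, hf⟩ : ∃ x, x = f' + 2 * 0 * c' + 0 ^ 2 * a := ⟨_, rfl⟩
    rw [← hb] at hk1 hk2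
    rw [← hb, ← hc, ← hd, ← he, ← hf]
    have hg : a * d' - b' ^ 2 = a * d - b ^ 2 := by subst hb hd; ring
    have hdet : a * d * f + 2 * b * c * e - a * e ^ 2 - d * c ^ 2 - f * b ^ 2 = 1 := by
      rw [← hdet']
      subst hb hc hd he hf; ring
    rw [hg] at h2 h3
    clear hg hb hc hd he hf hdet'
    clear b' c' d' e' f' k
    have hd0 : 0 < d := by
      by_contra hc
      nlinarith [sq_nonneg b]
    by_cases h : a ≤ d
    · -- reduced case
      have h4 : 3 * a ^ 2 ≤ 4 * (a * d - b ^ 2) := by nlinarith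
      have ha1 : a = 1 := by
        by_contra hne
        have ha2 : 2 ≤ a := by omega
        generalize a * d - b ^ 2 = g at *
        have h5 : (3 * a ^ 2) ^ 2 ≤ (4 * g) ^ 2 := by gcongr
        have h6 : 27 * a ^ 3 ≤ 64 := by
          by_contra hcon
          nlinarith
        have : 2 ^ 3 ≤ a ^ 3 := by gcongr
        omega
      subst ha1
      have hb0 : b = 0 := by omega
      subst hb0
      have hd1 : d = 1 := by nlinarith
      subst hd1
      refine ⟨1, 0, 0, 0, 1, 0, c, e, 1, ?_, ?_, ?_, ?_, ?_, ?_⟩ <;> linarith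
    · apply IsGram.swap
      exact ih d b e a c f (by omega) hd0 (by linarith) (by linarith)

theorem primitive_of_residue (m d t : ℤ) (hd : 0 < d) (hm : 0 < d * m - 1)
    (h : d * m - 1 ∣ t ^ 2 + d) :
    ∃ x y z : ℤ, m = x ^ 2 + y ^ 2 + z ^ 2 ∧ ∀ g : ℤ, g ∣ x → g ∣ y → g ∣ z → IsUnit g := by
  obtain ⟨a, ha⟩ := h
  have ha0 : 0 < a := by
    by_contra hc
    nlinarith [sq_nonneg t]
  obtain ⟨u₁, u₂, u₃, v₁, v₂, v₃, w₁, w₂, w₃, h1, h2, h3, h4, h5, h6⟩ :=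
    ternary _ a t 1 (d * m - 1) 0 m le_rfl ha0 (by linarith) (by linear_combination (-m) * ha)
  refine ⟨w₁, w₂, w₃, h6, ?_⟩
  rintro g ⟨x, rfl⟩ ⟨y, rfl⟩ ⟨z, rfl⟩
  have key : (u₁ * (v₂ * (g * z) - v₃ * (g * y)) - u₂ * (v₁ * (g * z) - v₃ * (g * x))
      + u₃ * (v₁ * (g * y) - v₂ * (g * x))) ^ 2 = 1 := by
    have e1 : a * (d * m - 1) * m + 2 * t * 1 * 0 - a * 0 ^ 2 - (d * m - 1) * 1 ^ 2 - m * t ^ 2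
      = 1 := by linear_combination (-m) * ha
    rw [← e1]
    generalize d * m - 1 = D at *
    generalize hone : (1 : ℤ) = o at h3 ⊢
    generalize hz : (0 : ℤ) = o' at h5 ⊢
    subst h1 h2 h3 h4 h5 h6
    ring
  apply IsUnit.of_mul_eq_one (g * (u₁ * (v₂ * z - v₃ * y) - u₂ * (v₁ * z - v₃ * x)
      + u₃ * (v₁ * y - v₂ * x)) ^ 2)
  rw [← key]; ring

open NumberTheorySymbols in
/-- The value `J(-d | p)` after reciprocity. -/
theorem jacobi_neg_flip (p d : ℕ) (hp : p % 2 = 1) (hd : d % 2 = 1)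
    (h : p % 4 = 1 ∨ (p % 4 = 3 ∧ d % 4 = 3)) : J(-(d : ℤ) | p) = J((p : ℤ) | d) := by
  rw [← neg_one_mul, jacobiSym.mul_left, jacobiSym.at_neg_one (Nat.odd_iff.2 hp)]
  rcases h with h | ⟨h, h'⟩
  · rw [ZMod.χ₄_nat_one_mod_four h, one_mul,
      jacobiSym.quadratic_reciprocity_one_mod_four h (Nat.odd_iff.2 hd)]
  · rw [ZMod.χ₄_nat_three_mod_four h, jacobiSym.quadratic_reciprocity_three_mod_four h' h]
    ring

open NumberTheorySymbols in
theorem exists_root (p d : ℕ) (hp : p.Prime) (h : J(-(d : ℤ) | p) = 1) :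
    ∃ t : ℤ, (p : ℤ) ∣ t ^ 2 + d := by
  haveI := Fact.mk hp
  obtain ⟨r, hr⟩ := ZMod.isSquare_of_jacobiSym_eq_one h
  refine ⟨r.val, ?_⟩
  rw [← ZMod.intCast_zmod_eq_zero_iff_dvd]
  push_cast at hr ⊢
  rw [ZMod.natCast_zmod_val, sq, ← hr]
  ring

open NumberTheorySymbols in
theorem root_even (m : ℕ) (hm : m % 4 = 2) :
    ∃ d t : ℤ, 0 < d ∧ 0 < d * m - 1 ∧ d * m - 1 ∣ t ^ 2 + d := by
  have hco : Nat.Coprime (m - 1) (4 * m) := by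
    apply Nat.Coprime.mul_right
    · apply Nat.Coprime.pow_right 2 (k := m - 1) (m := 2)
      rw [Nat.coprime_two_right, Nat.odd_iff]; omega
    · exact (Nat.coprime_self_sub_left (by omega)).2 (by simp)
  obtain ⟨p, hpgt, hp, hmod⟩ := Nat.forall_exists_prime_gt_and_modEq m (by omega) hco
  obtain ⟨j, hj⟩ := (Nat.modEq_iff_dvd' (by omega)).1 hmod.symm
  have hp1 : p = (4 * j + 1) * m - 1 := by
    have : p = 4 * m * j + (m - 1) := by omega
    rw [this, add_mul, show 4 * m * j = 4 * j * m by ring]; omega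
  have hp2 : p + 1 = (4 * j + 1) * m := by
    have : 0 < (4 * j + 1) * m := by apply Nat.mul_pos <;> omega
    omega
  have hp4 : p % 4 = 1 := by
    have : p = 4 * (m * j) + (m - 1) := by rw [← mul_assoc]; omega
    omega
  have hJ : J(-((4 * j + 1 : ℕ) : ℤ) | p) = 1 := by
    rw [jacobi_neg_flip p (4 * j + 1) (by omega) (by omega) (Or.inl hp4)]
    rw [jacobiSym.mod_left' (a₂ := -1), jacobiSym.at_neg_one (Nat.odd_iff.2 (by omega)),
      ZMod.χ₄_nat_one_mod_four (by omega)]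
    apply Int.ModEq.symm
    rw [Int.modEq_iff_dvd]
    refine ⟨m, ?_⟩
    have : ((p + 1 : ℕ) : ℤ) = (((4 * j + 1) * m : ℕ) : ℤ) := by rw [hp2]
    push_cast at this ⊢
    linarith
  obtain ⟨t, ht⟩ := exists_root p _ hp hJ
  have e : ((4 * j + 1 : ℕ) : ℤ) * m - 1 = p := by
    have : ((p + 1 : ℕ) : ℤ) = (((4 * j + 1) * m : ℕ) : ℤ) := by rw [hp2]
    push_cast at this ⊢
    linarith
  exact ⟨(4 * j + 1 : ℕ), t, by positivity, by rw [e]; exact_mod_cast hp.pos, by rw [e]; exact ht⟩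

open NumberTheorySymbols in
theorem root_odd (m c : ℕ) (hm : m % 8 = 3 ∧ c = 1 ∨ (m % 8 = 1 ∨ m % 8 = 5) ∧ c = 3) :
    ∃ d t : ℤ, 0 < d ∧ 0 < d * m - 1 ∧ d * m - 1 ∣ t ^ 2 + d := by
  obtain ⟨a, ha⟩ : ∃ a, c * m = 2 * a + 1 := by
    rcases hm with ⟨h, rfl⟩ | ⟨h, rfl⟩
    · exact ⟨(m - 1) / 2, by omega⟩
    · exact ⟨(3 * m - 1) / 2, by omega⟩
  have ha4 : a % 4 = 1 ∨ (a % 4 = 3 ∧ c = 3) := by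
    rcases hm with ⟨h, rfl⟩ | ⟨h, rfl⟩ <;> omega
  have hc : c = 1 ∨ c = 3 := by omega
  have hco : Nat.Coprime a (4 * m) := by
    apply Nat.Coprime.mul_right
    · apply Nat.Coprime.pow_right 2 (k := a) (m := 2)
      rw [Nat.coprime_two_right, Nat.odd_iff]; omega
    · rw [← Nat.isCoprime_iff_coprime]
      refine ⟨-2, c, ?_⟩
      have : ((c * m : ℕ) : ℤ) = ((2 * a + 1 : ℕ) : ℤ) := by rw [ha]
      push_cast at this
      linarith
  obtain ⟨p, hpgt, hp, hmod⟩ := Nat.forall_exists_prime_gt_and_modEq a (by omega) hco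
  obtain ⟨j, hj⟩ := (Nat.modEq_iff_dvd' (by omega)).1 hmod.symm
  have hp0 : p = 4 * (m * j) + a := by rw [← mul_assoc]; omega
  obtain ⟨d, hd⟩ : ∃ d, d = 8 * j + c := ⟨_, rfl⟩
  have hp2 : (2 * p + 1 : ℤ) = d * m := by
    have : ((c * m : ℕ) : ℤ) = ((2 * a + 1 : ℕ) : ℤ) := by rw [ha]
    push_cast at this
    rw [hp0, hd]; push_cast
    linarith
  have hJ : J(-(d : ℤ) | p) = 1 := by
    rw [jacobi_neg_flip p d (by omega) (by omega) (by omega)]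
    have h2 : J(-2 | d) = 1 := by
      rw [jacobiSym.at_neg_two (Nat.odd_iff.2 (by omega)), ZMod.χ₈'_nat_eq_if_mod_eight,
        if_neg (by omega), if_pos (by omega)]
    have h3 : J(-2 * (p : ℤ) | d) = 1 := by
      rw [jacobiSym.mod_left' (a₂ := 1), jacobiSym.one_left]
      apply Int.ModEq.symm
      rw [Int.modEq_iff_dvd]
      exact ⟨-m, by linarith⟩
    rwa [jacobiSym.mul_left, h2, one_mul] at h3
  obtain ⟨t, ht⟩ := exists_root p _ hp hJ
  have e : (d : ℤ) * m - 1 = 2 * p := by linarith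
  have hpp := hp.pos
  have hdodd : (d : ℤ) % 2 = 1 := by omega
  have hpodd : (p : ℤ) % 2 = 1 := by omega
  obtain ⟨s, hs, hs2⟩ : ∃ s : ℤ, (p : ℤ) ∣ s ^ 2 + d ∧ s % 2 = 1 := by
    rcases Int.emod_two_eq_zero_or_one t with h | h
    · refine ⟨t + p, ?_, by omega⟩
      have : (t + p) ^ 2 + (d : ℤ) = (t ^ 2 + d) + p * (2 * t + p) := by ring
      rw [this]
      exact dvd_add ht (dvd_mul_right _ _)
    · exact ⟨t, ht, h⟩
  refine ⟨d, s, by omega, by omega, ?_⟩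
  rw [e]
  apply IsCoprime.mul_dvd _ _ hs
  · exact ⟨-(p / 2), 1, by omega⟩
  · have : s ^ 2 % 2 = 1 := by rw [pow_two, Int.mul_emod, hs2]; rfl
    omega

theorem primitive_rep (m : ℕ) (h4 : m % 4 ≠ 0) (h7 : m % 8 ≠ 7) :
    ∃ x y z : ℕ, m = x ^ 2 + y ^ 2 + z ^ 2 ∧ Nat.gcd x (Nat.gcd y z) = 1 := by
  obtain ⟨d, t, h1, h2, h3⟩ : ∃ d t : ℤ, 0 < d ∧ 0 < d * m - 1 ∧ d * m - 1 ∣ t ^ 2 + d := by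
    by_cases he : m % 4 = 2
    · exact root_even m he
    · by_cases h : m % 8 = 3
      · exact root_odd m 1 (by omega)
      · exact root_odd m 3 (by omega)
  obtain ⟨x, y, z, hs, hg⟩ := primitive_of_residue m d t h1 h2 h3
  refine ⟨x.natAbs, y.natAbs, z.natAbs, ?_, ?_⟩
  · zify
    simpa using hs
  · have := hg (Nat.gcd x.natAbs (Nat.gcd y.natAbs z.natAbs) : ℕ)
      (Int.natCast_dvd.2 (Nat.gcd_dvd_left _ _))
      (Int.natCast_dvd.2 ((Nat.gcd_dvd_right _ _).trans (Nat.gcd_dvd_left _ _)))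
      (Int.natCast_dvd.2 ((Nat.gcd_dvd_right _ _).trans (Nat.gcd_dvd_right _ _)))
    simpa [Int.isUnit_iff_natAbs_eq] using this

/-- Refined Legendre three-square theorem (Dirichlet's proof): every positive
integer `n` not of the form `4^a*(8b+7)` is a sum of three squares whose gcd is
`2^l`, where `4^l` is the largest power of `4` dividing `n`. -/
theorem stmt_0 (n : ℕ) (hn : 0 < n)
    (hform : ¬ ∃ a b : ℕ, n = 4 ^ a * (8 * b + 7))
    (l : ℕ) (hl : 4 ^ l ∣ n) (hl' : ¬ 4 ^ (l + 1) ∣ n) :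
    ∃ m1 m2 m3 : ℕ, n = m1 ^ 2 + m2 ^ 2 + m3 ^ 2 ∧
      Nat.gcd m1 (Nat.gcd m2 m3) = 2 ^ l := by
  obtain ⟨m, rfl⟩ := hl
  have h4 : m % 4 ≠ 0 := by
    intro h
    apply hl'
    rw [pow_succ]
    exact Nat.mul_dvd_mul_left _ (Nat.dvd_of_mod_eq_zero h)
  have h7 : m % 8 ≠ 7 := by
    intro h
    exact hform ⟨l, m / 8, by congr 1; omega⟩
  obtain ⟨x, y, z, hs, hg⟩ := primitive_rep m h4 h7
  refine ⟨2 ^ l * x, 2 ^ l * y, 2 ^ l * z, ?_, ?_⟩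
  · rw [hs, show (4 : ℕ) = 2 ^ 2 by norm_num, ← pow_mul]
    ring
  · rw [Nat.gcd_mul_left, Nat.gcd_mul_left, hg, mul_one]
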